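/- Let μ be a Borel probability measure on the extended real line ℝ̄ = ℝ∪{−∞,+∞} with μ({−∞})=μ({+∞})=0, and define Φ[X] = ∫_{ℝ̄} K_a[X] dμ(a) for every finitely supported real-valued lottery X. Then every finite normal-form game G=(A,u) has a Nash_Φ equilibrium, i.e., a mixed strategy profile p such that for every player i, the support of p_i is contained in argmax_{a_i∈A_i} Φ[u_i(a_i,p_{-i})]. -/

import Mathlib

open Filter Topology MeasureTheory

noncomputable section

namespace Paper

/-! ## Lotteries as finitely supported probability mass functions on ℝ -/

open Classical in
/-- The point mass at `a`. -/
def delta {α : Type*} (a : α) : α → ℝ := fun b => if b = a then 1 else 0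

/-- `f` is (the p.m.f. of) a finitely supported lottery. -/
def IsFinLottery (f : ℝ → ℝ) : Prop :=
  (∀ x, 0 ≤ f x) ∧ (Function.support f).Finite ∧ ∑ᶠ x, f x = 1

/-- The CDF of a mass function. -/
def cdfOf (f : ℝ → ℝ) (t : ℝ) : ℝ := ∑ᶠ x, if x ≤ t then f x else 0

/-- Convolution: the distribution of the sum of independent draws. -/
def conv (f g : ℝ → ℝ) : ℝ → ℝ := fun z => ∑ᶠ x, f x * g (z - x)

/-- Expectation of a finitely supported lottery. -/
def expOf (f : ℝ → ℝ) : ℝ := ∑ᶠ x, x * f x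

/-- Weak first-order stochastic dominance of `f` over `g`. -/
def FOSDgeF (f g : ℝ → ℝ) : Prop := ∀ t, cdfOf f t ≤ cdfOf g t

/-- Strict first-order stochastic dominance of `f` over `g`. -/
def FOSDgtF (f g : ℝ → ℝ) : Prop := FOSDgeF f g ∧ f ≠ g

/-- Finitely supported lotteries with rational-valued CDF (`Δ_ℚ`). -/
def IsDeltaQ (f : ℝ → ℝ) : Prop := IsFinLottery f ∧ ∀ t, ∃ q : ℚ, cdfOf f t = (q : ℝ)

/-- Monotone additive statistic on all finitely supported lotteries. -/
def MAS (Φ : (ℝ → ℝ) → ℝ) : Prop :=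
  (∀ c : ℝ, Φ (delta c) = c) ∧
  (∀ f g, IsFinLottery f → IsFinLottery g → Φ (conv f g) = Φ f + Φ g) ∧
  (∀ f g, IsFinLottery f → IsFinLottery g → FOSDgeF f g → Φ g ≤ Φ f)

/-- Monotone additive statistic on `Δ_ℚ`. -/
def MASQ (Φ : (ℝ → ℝ) → ℝ) : Prop :=
  (∀ c : ℝ, Φ (delta c) = c) ∧
  (∀ f g, IsDeltaQ f → IsDeltaQ g → Φ (conv f g) = Φ f + Φ g) ∧
  (∀ f g, IsDeltaQ f → IsDeltaQ g → FOSDgeF f g → Φ g ≤ Φ f)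

/-- The statistic `K_a` for `a` in the extended real line. -/
def Kstat (a : EReal) (f : ℝ → ℝ) : ℝ :=
  if a = ⊤ then sSup (Function.support f)
  else if a = ⊥ then sInf (Function.support f)
  else if a = 0 then expOf f
  else (a.toReal)⁻¹ * Real.log (∑ᶠ x, Real.exp (a.toReal * x) * f x)

/-- `K_a` for real `a`. -/
def Kreal (a : ℝ) : (ℝ → ℝ) → ℝ := Kstat (a : EReal)

/-- The statistic `Φ[X] = ∫ K_a[X] dμ(a)`. -/
def PhiInt (μ : Measure EReal) (f : ℝ → ℝ) : ℝ := ∫ a, Kstat a f ∂μ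

/-! ## Finite normal-form games -/

structure Game (N : ℕ) where
  A : Fin N → Type
  fintypeA : ∀ i, Fintype (A i)
  nonemptyA : ∀ i, Nonempty (A i)
  u : ((i : Fin N) → A i) → Fin N → ℝ

instance {N : ℕ} (G : Game N) (i : Fin N) : Fintype (G.A i) := G.fintypeA i
instance {N : ℕ} (G : Game N) (i : Fin N) : Nonempty (G.A i) := G.nonemptyA i

/-- A (mixed strategy) profile: a real-valued function on each action set. -/
abbrev Profile {N : ℕ} (G : Game N) := (i : Fin N) → G.A i → ℝ

/-- `p` is a mixed strategy profile. -/
def IsMixed {N : ℕ} (G : Game N) (p : Profile G) : Prop :=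
  ∀ i, (∀ ai, 0 ≤ p i ai) ∧ ∑ ai, p i ai = 1

/-- Probability of the full action profile `a` under independent mixing `p`. -/
def weight {N : ℕ} (G : Game N) (p : Profile G) (a : (i : Fin N) → G.A i) : ℝ :=
  ∏ j, p j (a j)

/-- The p.m.f. of player `i`'s payoff lottery `u_i(a_i, p_{-i})`. -/
def payMass {N : ℕ} (G : Game N) (p : Profile G) (i : Fin N) (ai : G.A i) : ℝ → ℝ :=
  fun t => ∑ a : (j : Fin N) → G.A j,
    if G.u a i = t then weight G (Function.update p i (delta ai)) a else 0

/-- Expected payoff `E[u_i(a_i, p_{-i})]`. -/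
def expPay {N : ℕ} (G : Game N) (p : Profile G) (i : Fin N) (ai : G.A i) : ℝ :=
  ∑ a : (j : Fin N) → G.A j, weight G (Function.update p i (delta ai)) a * G.u a i

/-- Expected value of `f` applied to player `i`'s payoff lottery. -/
def expPayOf {N : ℕ} (G : Game N) (p : Profile G) (i : Fin N) (ai : G.A i) (f : ℝ → ℝ) : ℝ :=
  ∑ a : (j : Fin N) → G.A j, weight G (Function.update p i (delta ai)) a * f (G.u a i)

/-- Minimum over `a_{-i}` of `u_i(a_i, a_{-i})`. -/
def minPay {N : ℕ} (G : Game N) (i : Fin N) (ai : G.A i) : ℝ :=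
  ⨅ a : (j : Fin N) → G.A j, G.u (Function.update a i ai) i

/-- Maximum over `a_{-i}` of `u_i(a_i, a_{-i})`. -/
def maxPay {N : ℕ} (G : Game N) (i : Fin N) (ai : G.A i) : ℝ :=
  ⨆ a : (j : Fin N) → G.A j, G.u (Function.update a i ai) i

/-- `a_i` is strictly dominated (by some `b_i`). -/
def StrictlyDominated {N : ℕ} (G : Game N) (i : Fin N) (ai : G.A i) : Prop :=
  ∃ bi : G.A i, ∀ a : (j : Fin N) → G.A j,
    G.u (Function.update a i ai) i < G.u (Function.update a i bi) i

/-! ## Solution concepts and axioms -/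

abbrev SolCon (N : ℕ) := (G : Game N) → Set (Profile G)

/-- A solution concept assigns to each game a nonempty set of mixed strategy profiles. -/
def IsSolutionConcept {N : ℕ} (S : SolCon N) : Prop :=
  ∀ G, (S G).Nonempty ∧ ∀ p ∈ S G, IsMixed G p

/-- The composite game `G ⊗ H`. -/
def Game.comp {N : ℕ} (G H : Game N) : Game N where
  A := fun i => G.A i × H.A i
  fintypeA := fun i => inferInstance
  nonemptyA := fun i => inferInstance
  u := fun c i => G.u (fun j => (c j).1) i + H.u (fun j => (c j).2) i

/-- The product profile `p × q`. -/
def prodProfile {N : ℕ} {G H : Game N} (p : Profile G) (q : Profile H) :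
    Profile (G.comp H) := fun i ab => p i ab.1 * q i ab.2

def Bracketing {N : ℕ} (S : SolCon N) : Prop :=
  ∀ (G H : Game N) (p : Profile G) (q : Profile H),
    p ∈ S G → q ∈ S H → prodProfile p q ∈ S (G.comp H)

/-- The permuted game `G_π`. -/
def Game.permute {N : ℕ} (G : Game N) (π : Equiv.Perm (Fin N)) : Game N where
  A := fun i => G.A (π i)
  fintypeA := fun i => G.fintypeA (π i)
  nonemptyA := fun i => G.nonemptyA (π i)
  u := fun b i =>
    G.u (fun j => cast (congrArg G.A (π.apply_symm_apply j)) (b (π.symm j))) (π i)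

def Anonymity {N : ℕ} (S : SolCon N) : Prop :=
  ∀ (π : Equiv.Perm (Fin N)) (G : Game N) (p : Profile G),
    p ∈ S G → (fun i => p (π i)) ∈ S (G.permute π)

def ExpectationMonotone {N : ℕ} (S : SolCon N) : Prop :=
  ∀ G, ∀ p ∈ S G, ∀ i, ∀ ai bi : G.A i,
    expPay G p i bi < expPay G p i ai → p i bi ≤ p i ai

def ExpectationNeutral {N : ℕ} (S : SolCon N) : Prop :=
  ∀ G, ∀ p ∈ S G, ∀ i, ∀ ai bi : G.A i,
    expPay G p i ai = expPay G p i bi → p i ai = p i bi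

def DistributionMonotone {N : ℕ} (S : SolCon N) : Prop :=
  ∀ G, ∀ p ∈ S G, ∀ i, ∀ ai bi : G.A i,
    FOSDgtF (payMass G p i ai) (payMass G p i bi) → p i bi ≤ p i ai

def Interiority {N : ℕ} (S : SolCon N) : Prop :=
  ∀ G, ∀ p ∈ S G, ∀ i, ∀ ai : G.A i, 0 < p i ai

/-- The game with payoffs rescaled by `α`. -/
def Game.scale {N : ℕ} (G : Game N) (α : ℝ) : Game N :=
  { G with u := fun a i => α * G.u a i }

def ScaleInvariant {N : ℕ} (S : SolCon N) : Prop :=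
  ∀ G : Game N, ∀ p ∈ S G,
    (∀ i, ∀ ai : G.A i, p i ai = ((Fintype.card (G.A i) : ℝ))⁻¹) →
    ∀ α ∈ Set.Ioo (0 : ℝ) 1, p ∈ S (G.scale α)

def StratInvariant {N : ℕ} (S : SolCon N) : Prop :=
  ∀ (G : Game N) (u' : ((i : Fin N) → G.A i) → Fin N → ℝ),
    (∀ i, ∃ w : ((j : Fin N) → G.A j) → ℝ,
      (∀ a, ∀ bi : G.A i, w (Function.update a i bi) = w a) ∧
      (∀ a, u' a i = G.u a i + w a)) →
    S G = S { G with u := u' }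

/-! ## Equilibrium notions -/

def IsNash {N : ℕ} (G : Game N) (p : Profile G) : Prop :=
  ∀ i, ∀ ai : G.A i, 0 < p i ai → ∀ bi : G.A i, expPay G p i bi ≤ expPay G p i ai

def IsLQRE {N : ℕ} (lam : ℝ) (G : Game N) (p : Profile G) : Prop :=
  ∀ i, ∀ ai : G.A i,
    p i ai = Real.exp (lam * expPay G p i ai) / ∑ bi, Real.exp (lam * expPay G p i bi)

def IsNashPhi {N : ℕ} (Φ : (ℝ → ℝ) → ℝ) (G : Game N) (p : Profile G) : Prop :=
  ∀ i, ∀ ai : G.A i, 0 < p i ai → ∀ bi : G.A i,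
    Φ (payMass G p i bi) ≤ Φ (payMass G p i ai)

def IsLQREPhi {N : ℕ} (Φ : (ℝ → ℝ) → ℝ) (lam : ℝ) (G : Game N) (p : Profile G) : Prop :=
  ∀ i, ∀ ai : G.A i,
    p i ai = Real.exp (lam * Φ (payMass G p i ai)) /
      ∑ bi, Real.exp (lam * Φ (payMass G p i bi))

def IsFOSDNash {N : ℕ} (G : Game N) (p : Profile G) : Prop :=
  ∀ i, ∀ ai : G.A i,
    (∃ bi : G.A i, FOSDgtF (payMass G p i bi) (payMass G p i ai)) → p i ai = 0

def IsFOSDQRE {N : ℕ} (G : Game N) (p : Profile G) : Prop :=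
  (∀ i, ∀ ai : G.A i, 0 < p i ai) ∧
  ∀ i, ∀ ai bi : G.A i,
    FOSDgeF (payMass G p i ai) (payMass G p i bi) → p i bi ≤ p i ai

def IsMinMaxMean {N : ℕ} (l1 l2 l3 : ℝ) (G : Game N) (p : Profile G) : Prop :=
  ∀ i, ∀ ai : G.A i,
    p i ai = Real.exp (l1 * minPay G i ai + l2 * expPay G p i ai + l3 * maxPay G i ai) /
      ∑ bi, Real.exp (l1 * minPay G i bi + l2 * expPay G p i bi + l3 * maxPay G i bi)

def CompatibleEU {N : ℕ} (S : SolCon N) : Prop :=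
  ∃ f : ℝ → ℝ, StrictMono f ∧ Continuous f ∧
    ∀ G, ∀ p ∈ S G, ∀ i, ∀ ai bi : G.A i,
      expPayOf G p i bi f < expPayOf G p i ai f → p i bi ≤ p i ai

/-! ## Lotteries as compactly supported probability measures on ℝ -/

/-- Convolution of measures: distribution of the sum of independent draws. -/
def mconv (μ ν : Measure ℝ) : Measure ℝ := (μ.prod ν).map (fun z : ℝ × ℝ => z.1 + z.2)

/-- `npow μ m` is the `m`-fold convolution `μ^m`. -/
def npow (μ : Measure ℝ) : ℕ → Measure ℝ
  | 0 => Measure.dirac 0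
  | n + 1 => mconv (npow μ n) μ

/-- The distribution of `β` times a draw from `μ`. -/
def mscale (β : ℝ) (μ : Measure ℝ) : Measure ℝ := μ.map (fun x => β * x)

/-- `μ` is compactly supported. -/
def CompSupp (μ : Measure ℝ) : Prop := ∃ a b : ℝ, μ (Set.Icc a b)ᶜ = 0

/-- The minimum of the support of `μ`. -/
def minSupp (μ : Measure ℝ) : ℝ := sSup {x : ℝ | μ (Set.Iio x) = 0}

/-- The maximum of the support of `μ`. -/
def maxSupp (μ : Measure ℝ) : ℝ := sInf {x : ℝ | μ (Set.Ioi x) = 0}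

/-- Weak first-order stochastic dominance of `μ` over `ν`. -/
def FOSDgeM (μ ν : Measure ℝ) : Prop := ∀ t, μ (Set.Iic t) ≤ ν (Set.Iic t)

/-- Strict first-order stochastic dominance of `μ` over `ν`. -/
def FOSDgtM (μ ν : Measure ℝ) : Prop := FOSDgeM μ ν ∧ μ ≠ ν

/-- Monotone additive statistic on compactly supported lotteries (as measures). -/
def MASm (Φ : Measure ℝ → ℝ) : Prop :=
  (∀ c : ℝ, Φ (Measure.dirac c) = c) ∧
  (∀ μ ν : Measure ℝ, IsProbabilityMeasure μ → IsProbabilityMeasure ν →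
    CompSupp μ → CompSupp ν → Φ (mconv μ ν) = Φ μ + Φ ν) ∧
  (∀ μ ν : Measure ℝ, IsProbabilityMeasure μ → IsProbabilityMeasure ν →
    CompSupp μ → CompSupp ν → FOSDgeM μ ν → Φ ν ≤ Φ μ)

/-! ## Two-player games, unbundled -/

/-- `p` is a probability distribution on the finite type `α`. -/
def IsDist {α : Type*} [Fintype α] (p : α → ℝ) : Prop :=
  (∀ a, 0 ≤ p a) ∧ ∑ a, p a = 1

/-- Payoff lottery of player 1 playing `a` against the mixed strategy `q`. -/
def mass1 {α β : Type*} [Fintype β] (u : α → β → ℝ) (q : β → ℝ) (a : α) : ℝ → ℝ :=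
  fun t => ∑ b, if u a b = t then q b else 0

/-- Payoff lottery of player 2 playing `b` against the mixed strategy `p`. -/
def mass2 {α β : Type*} [Fintype α] (u : α → β → ℝ) (p : α → ℝ) (b : β) : ℝ → ℝ :=
  fun t => ∑ a, if u a b = t then p a else 0

/-- The distribution of a random variable on the uniform space `{1,…,m}`. -/
def distOf {m : ℕ} (X : Fin m → ℝ) : ℝ → ℝ :=
  fun t => (∑ ω : Fin m, if X ω = t then (1 : ℝ) else 0) / m

open Metric

theorem det_one_add_smul_eq_sum {E : Type*} [NormedAddCommGroup E] [NormedSpace ℝ E]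
    [FiniteDimensional ℝ E] :
    ∃ (n : ℕ) (c : ℕ → C(E →L[ℝ] E, ℝ)), ∀ (A : E →L[ℝ] E) (t : ℝ),
      (ContinuousLinearMap.id ℝ E + t • A).det = ∑ k ∈ Finset.range n, c k A * t ^ k := by
  classical
  let b := Module.finBasis ℝ E
  let L : (E →L[ℝ] E) →ₗ[ℝ] Matrix _ _ ℝ :=
    (LinearMap.toMatrix b b).toLinearMap ∘ₗ ContinuousLinearMap.coeLM ℝ
  have hL : Continuous L := L.continuous_of_finiteDimensional
  let M : Matrix (Fin (Module.finrank ℝ E)) (Fin (Module.finrank ℝ E))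
      (Polynomial C(E →L[ℝ] E, ℝ)) :=
    1 + Matrix.of fun i j => Polynomial.X * Polynomial.C ⟨fun A => L A i j, hL.matrix_elem i j⟩
  refine ⟨M.det.natDegree + 1, fun k => M.det.coeff k, fun A t => ?_⟩
  let ev : C(E →L[ℝ] E, ℝ) →+* ℝ :=
    { toFun := fun f => f A, map_one' := rfl, map_mul' := fun _ _ => rfl,
      map_zero' := rfl, map_add' := fun _ _ => rfl }
  have h1 := Polynomial.eval₂_eq_sum_range (p := M.det) ev t
  have h2 : Polynomial.eval₂ ev t M.det = ((Polynomial.eval₂RingHom ev t).mapMatrix M).det :=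
    RingHom.map_det (Polynomial.eval₂RingHom ev t) M
  have h3 : (Polynomial.eval₂RingHom ev t).mapMatrix M =
      LinearMap.toMatrix b b ((ContinuousLinearMap.id ℝ E + t • A : E →L[ℝ] E) : E →ₗ[ℝ] E) := by
    have : LinearMap.toMatrix b b
        ((ContinuousLinearMap.id ℝ E + t • A : E →L[ℝ] E) : E →ₗ[ℝ] E) = 1 + t • L A := by
      rw [ContinuousLinearMap.toLinearMap_add, map_add, ContinuousLinearMap.toLinearMap_smul,
        map_smul,
        show ((ContinuousLinearMap.id ℝ E : E →L[ℝ] E) : E →ₗ[ℝ] E) = LinearMap.id from rfl,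
        LinearMap.toMatrix_id]
      rfl
    rw [this, map_add, map_one]
    congr 1
    ext i j
    simp only [RingHom.mapMatrix_apply, Matrix.map_apply, Matrix.of_apply,
      Polynomial.coe_eval₂RingHom, Polynomial.eval₂_mul, Polynomial.eval₂_X, Polynomial.eval₂_C]
    rfl
  rw [h3, LinearMap.det_toMatrix] at h2
  exact h2.symm.trans h1

theorem det_one_add_smul_pos {E : Type*} [NormedAddCommGroup E] [NormedSpace ℝ E]
    [FiniteDimensional ℝ E] (A : E →L[ℝ] E) {t : ℝ} (ht : 0 ≤ t) (h : t * ‖A‖ < 1) :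
    0 < (ContinuousLinearMap.id ℝ E + t • A).det := by
  have hne : ∀ s ∈ Set.Icc 0 t, (ContinuousLinearMap.id ℝ E + s • A).det ≠ 0 := by
    intro s hs h0
    obtain ⟨v, hv, hv0⟩ := (Submodule.ne_bot_iff _).1 (LinearMap.bot_lt_ker_of_det_eq_zero h0).ne'
    have hv1 : v + s • A v = 0 := by simpa using hv
    have hpos : 0 < ‖v‖ := norm_pos_iff.2 hv0
    have h1 : ‖v‖ ≤ s * (‖A‖ * ‖v‖) := by
      calc ‖v‖ = ‖s • A v‖ := by
            simpa using congrArg norm (eq_neg_of_add_eq_zero_left hv1)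
        _ = s * ‖A v‖ := by rw [norm_smul, Real.norm_of_nonneg hs.1]
        _ ≤ _ := mul_le_mul_of_nonneg_left (A.le_opNorm v) hs.1
    have h2 : s * ‖A‖ ≤ t * ‖A‖ := mul_le_mul_of_nonneg_right hs.2 (norm_nonneg _)
    nlinarith
  obtain ⟨n, c, hc⟩ := det_one_add_smul_eq_sum (E := E)
  have hcont : Continuous fun s : ℝ => (ContinuousLinearMap.id ℝ E + s • A).det := by
    simp_rw [hc]; fun_prop
  by_contra! hle
  have h0 : (ContinuousLinearMap.id ℝ E + (0 : ℝ) • A).det = 1 := by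
    simp [ContinuousLinearMap.det]
  obtain ⟨s, hs, hs0⟩ := intermediate_value_Icc' ht hcont.continuousOn
    (show (0 : ℝ) ∈ Set.Icc _ _ from ⟨hle, by simp only [h0]; exact zero_le_one⟩)
  exact hne s hs hs0

theorem lipschitzWith_indicator_closedBall {E F : Type*} [NormedAddCommGroup E] [NormedSpace ℝ E]
    [NormedAddCommGroup F] {g : E → F} {K : NNReal}
    (hg : LipschitzOnWith K g (closedBall 0 1)) (h0 : ∀ x ∈ sphere (0 : E) 1, g x = 0) :
    LipschitzWith K ((closedBall (0 : E) 1).indicator g) := by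
  have key : ∀ x ∈ closedBall (0 : E) 1, ∀ y ∉ closedBall (0 : E) 1,
      dist (g x) 0 ≤ K * dist x y := by
    intro x hx y hy
    have hx' : ‖x‖ ≤ 1 := by simpa using hx
    have hy' : 1 < ‖y‖ := by simpa using hy
    have hc : ContinuousOn (fun s : ℝ => ‖AffineMap.lineMap x y s‖) (Set.Icc 0 1) := by
      have : Continuous fun s : ℝ => (AffineMap.lineMap x y s : E) := AffineMap.lineMap_continuous
      fun_prop
    obtain ⟨s, hs, hs1⟩ := intermediate_value_Icc zero_le_one hc
      (show (1 : ℝ) ∈ Set.Icc _ _ from ⟨by simpa using hx', by simpa using hy'.le⟩)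
    set z : E := AffineMap.lineMap x y s with hz
    have hzs : z ∈ sphere (0 : E) 1 := by simpa using hs1
    have h1 := hg.dist_le_mul x hx z (sphere_subset_closedBall hzs)
    rw [h0 z hzs] at h1
    refine h1.trans (mul_le_mul_of_nonneg_left ?_ K.2)
    rw [hz, dist_left_lineMap, Real.norm_of_nonneg hs.1]
    exact mul_le_of_le_one_left dist_nonneg hs.2
  refine LipschitzWith.of_dist_le_mul fun x y => ?_
  by_cases hx : x ∈ closedBall (0 : E) 1 <;> by_cases hy : y ∈ closedBall (0 : E) 1
  · simpa only [Set.indicator_of_mem hx, Set.indicator_of_mem hy] using hg.dist_le_mul x hx y hy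
  · simpa only [Set.indicator_of_mem hx, Set.indicator_of_notMem hy] using key x hx y hy
  · rw [Set.indicator_of_notMem hx, Set.indicator_of_mem hy, dist_comm, dist_comm x]
    exact key y hy x hx
  · simp only [Set.indicator_of_notMem hx, Set.indicator_of_notMem hy, dist_self]
    positivity

theorem det_eq_zero_of_norm_eventually_eq {E : Type*} [NormedAddCommGroup E]
    [InnerProductSpace ℝ E] [FiniteDimensional ℝ E] {h : E → E} {h' : E →L[ℝ] E} {x : E}
    (hd : HasFDerivAt h h' x) (h1 : ∀ᶠ y in 𝓝 x, ‖h y‖ = 1) : h'.det = 0 := by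
  have hc : (fun y => ‖h y‖ ^ 2) =ᶠ[𝓝 x] fun _ => (1 : ℝ) := h1.mono fun y hy => by simp [hy]
  have hz := (hd.norm_sq).unique ((hasFDerivAt_const (1 : ℝ) x).congr_of_eventuallyEq hc)
  have horth : ∀ v, inner ℝ (h x) (h' v) = 0 := fun v => by
    have := DFunLike.congr_fun hz v
    simpa using this
  by_contra hne
  obtain ⟨v, hv⟩ := (LinearMap.equivOfDetNeZero (h' : E →ₗ[ℝ] E) hne).surjective (h x)
  have hv' : h' v = h x := hv
  have := horth v
  rw [hv', real_inner_self_eq_norm_sq, h1.self_of_nhds] at this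
  norm_num at this

theorem bijOn_add_smul_closedBall {E : Type*} [NormedAddCommGroup E] [NormedSpace ℝ E]
    [FiniteDimensional ℝ E] {g : E → E} {K : NNReal}
    (hg : LipschitzOnWith K g (closedBall 0 1)) (h0 : ∀ x ∈ sphere (0 : E) 1, g x = 0)
    (h1 : ∀ x ∈ closedBall (0 : E) 1, ‖x + g x‖ = 1) {t : ℝ} (ht : 0 ≤ t) (ht1 : t ≤ 1)
    (hK : t * K < 1) :
    Set.BijOn (fun x => x + t • g x) (closedBall 0 1) (closedBall 0 1) := by
  have : CompleteSpace E := FiniteDimensional.complete ℝ E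
  refine ⟨fun x hx => ?_, fun x hx y hy hxy => ?_, fun y hy => ?_⟩
  · have hmem : x + g x ∈ closedBall (0 : E) 1 := by simpa using (h1 x hx).le
    simpa using convex_closedBall (0 : E) 1 |>.add_smul_mem hx hmem ⟨ht, ht1⟩
  · have h2 := hg.dist_le_mul x hx y hy
    have h3 : x - y = t • (g y - g x) := by
      rw [smul_sub, sub_eq_sub_iff_add_eq_add, add_comm (t • g y)]
      exact hxy.trans (add_comm _ _) |>.trans (add_comm _ _)
    have h4 : dist x y = t * dist (g x) (g y) := by
      rw [dist_eq_norm, h3, norm_smul, Real.norm_of_nonneg ht, dist_comm, dist_eq_norm]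
    have h5 : dist x y ≤ t * K * dist x y := by
      rw [mul_assoc]; exact h4.le.trans (mul_le_mul_of_nonneg_left h2 ht)
    have h6 := dist_nonneg (x := x) (y := y)
    exact dist_le_zero.1 (by nlinarith)
  · set G := (closedBall (0 : E) 1).indicator g with hG
    have hGl : LipschitzWith K G := lipschitzWith_indicator_closedBall hg h0
    have hcontr : ContractingWith (t.toNNReal * K) fun x => y - t • G x := by
      refine ⟨by rw [← NNReal.coe_lt_coe]; simpa [ht] using hK,
        LipschitzWith.of_dist_le_mul fun a b => ?_⟩
      rw [dist_sub_left, dist_smul₀, Real.norm_of_nonneg ht, NNReal.coe_mul, Real.coe_toNNReal t ht,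
        mul_assoc]
      exact mul_le_mul_of_nonneg_left (hGl.dist_le_mul a b) ht
    have hfix : y - t • G hcontr.fixedPoint = hcontr.fixedPoint := hcontr.fixedPoint_isFixedPt
    set x := hcontr.fixedPoint
    have hx : x ∈ closedBall (0 : E) 1 := by
      by_contra hx
      rw [hG, Set.indicator_of_notMem hx, smul_zero, sub_zero] at hfix
      exact hx (hfix ▸ hy)
    refine ⟨x, hx, ?_⟩
    rw [hG, Set.indicator_of_mem hx] at hfix
    exact (sub_eq_iff_eq_add.1 hfix).symm

/-- There is no `C¹` retraction `x ↦ x + g x` of the closed unit ball onto the sphere. -/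
theorem not_exists_contDiff_retraction {E : Type*} [NormedAddCommGroup E]
    [InnerProductSpace ℝ E] [FiniteDimensional ℝ E] {g : E → E} {g' : E → E →L[ℝ] E}
    (hd : ∀ x ∈ closedBall (0 : E) 1, HasFDerivAt g (g' x) x)
    (hc : ContinuousOn g' (closedBall 0 1)) (h0 : ∀ x ∈ sphere (0 : E) 1, g x = 0)
    (h1 : ∀ x ∈ closedBall (0 : E) 1, ‖x + g x‖ = 1) : False := by
  borelize E
  let B : Set E := closedBall 0 1
  have hB : IsCompact B := isCompact_closedBall 0 1
  obtain ⟨C, hC⟩ := hB.exists_bound_of_continuousOn hc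
  let K : NNReal := C.toNNReal
  have hK : ∀ x ∈ B, ‖g' x‖ ≤ K := fun x hx => (hC x hx).trans (Real.le_coe_toNNReal C)
  have hlip : LipschitzOnWith K g B :=
    (convex_closedBall (0 : E) 1).lipschitzOnWith_of_nnnorm_hasFDerivWithin_le
      (fun x hx => (hd x hx).hasFDerivWithinAt) hK
  let ν : Measure E := MeasureTheory.Measure.addHaar
  obtain ⟨n, c, hdet⟩ := det_one_add_smul_eq_sum (E := E)
  let P : Polynomial ℝ :=
    ∑ k ∈ Finset.range n, Polynomial.C (∫ x in B, c k (g' x) ∂ν) * Polynomial.X ^ k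
  have hint : ∀ k, IntegrableOn (fun x => c k (g' x)) B ν := fun k =>
    ((c k).continuous.comp_continuousOn hc).integrableOn_compact hB
  have hP : ∀ t, P.eval t = ∫ x in B, (ContinuousLinearMap.id ℝ E + t • g' x).det ∂ν := by
    intro t
    simp_rw [hdet]
    rw [integral_finsetSum _ fun k _ => (hint k).mul_const _]
    simp [P, Polynomial.eval_finsetSum, integral_mul_const]
  have hder : ∀ t : ℝ, ∀ x ∈ B,
      HasFDerivAt (fun x => x + t • g x) (ContinuousLinearMap.id ℝ E + t • g' x) x :=
    fun t x hx => (hasFDerivAt_id x).add ((hd x hx).const_smul t)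
  have hsmall : ∀ t : ℝ, 0 ≤ t → t ≤ 1 → t * K < 1 → P.eval t = ν.real B := by
    intro t ht ht1 htK
    have hbij := bijOn_add_smul_closedBall hlip h0 h1 ht ht1 htK
    have := integral_image_eq_integral_abs_det_fderiv_smul ν hB.measurableSet
      (fun x hx => (hder t x hx).hasFDerivWithinAt) hbij.injOn fun _ => (1 : ℝ)
    rw [hbij.image_eq] at this
    rw [hP, setIntegral_congr_fun
      (g := fun x => |(ContinuousLinearMap.id ℝ E + t • g' x).det| • (1 : ℝ))
      hB.measurableSet, ← this]
    · simp [B]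
    · intro x hx
      simp only [smul_eq_mul, mul_one]
      exact (abs_of_pos (det_one_add_smul_pos _ ht
        ((mul_le_mul_of_nonneg_left (hK x hx) ht).trans_lt htK))).symm
  have hconst : P = Polynomial.C (ν.real B) := by
    refine Polynomial.eq_of_infinite_eval_eq _ _ ((Set.Ioo_infinite
      (show (0 : ℝ) < 1 / (K + 1) by positivity)).mono fun t ht => ?_)
    have hK0 : (0 : ℝ) ≤ K := K.2
    have h2 : t * (K + 1) < 1 := (lt_div_iff₀ (by positivity)).1 ht.2
    have h3 := ht.1
    simpa using hsmall t h3.le (by nlinarith) (by nlinarith)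
  have hone : P.eval 1 = 0 := by
    rw [hP, ← integral_zero E ℝ (μ := ν.restrict B)]
    refine integral_congr_ae ?_
    rw [Filter.EventuallyEq, ae_restrict_iff' hB.measurableSet]
    have hs : ν (sphere (0 : E) 1) = 0 := Measure.addHaar_sphere_of_ne_zero ν 0 one_ne_zero
    filter_upwards [measure_eq_zero_iff_ae_notMem.1 hs] with x hxs hxB
    have hxb : x ∈ ball (0 : E) 1 := by
      rw [mem_ball]; exact lt_of_le_of_ne hxB hxs
    refine det_eq_zero_of_norm_eventually_eq (hder 1 x hxB) ?_
    filter_upwards [isOpen_ball.mem_nhds hxb] with y hy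
    simpa using h1 y (ball_subset_closedBall hy)
  rw [hconst, Polynomial.eval_C] at hone
  have hpos : 0 < ν.real B := ENNReal.toReal_pos
    (measure_closedBall_pos ν 0 one_pos).ne' hB.measure_lt_top.ne
  exact hpos.ne' hone

/-- **Brouwer's fixed point theorem** for `C¹` maps of the closed unit ball. -/
theorem exists_fixedPoint_of_contDiff {E : Type*} [NormedAddCommGroup E]
    [InnerProductSpace ℝ E] [FiniteDimensional ℝ E] {f : E → E} (hf : ContDiff ℝ 1 f)
    (hfB : ∀ x ∈ closedBall (0 : E) 1, ‖f x‖ ≤ 1) : ∃ x ∈ closedBall (0 : E) 1, f x = x := by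
  by_contra! hne
  let w : E → E := fun x => x - f x
  let a : E → ℝ := fun x => ‖w x‖ ^ 2
  let b : E → ℝ := fun x => inner ℝ x (w x)
  let e : E → ℝ := fun x => 1 - ‖x‖ ^ 2
  let d : E → ℝ := fun x => b x ^ 2 + a x * e x
  let lam : E → ℝ := fun x => (-b x + √(d x)) / a x
  have hw : ContDiff ℝ 1 w := contDiff_id.sub hf
  have ha : ContDiff ℝ 1 a := hw.norm_sq ℝ
  have hb : ContDiff ℝ 1 b := contDiff_id.inner ℝ hw
  have he : ContDiff ℝ 1 e := contDiff_const.sub (contDiff_id.norm_sq ℝ)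
  have hdd : ContDiff ℝ 1 d := (hb.pow 2).add (ha.mul he)
  have ha0 : ∀ x ∈ closedBall (0 : E) 1, 0 < a x := fun x hx =>
    pow_pos (norm_pos_iff.2 (sub_ne_zero.2 (hne x hx).symm)) 2
  have hb0 : ∀ x ∈ sphere (0 : E) 1, 0 < b x := by
    intro x hx
    have hx1 : ‖x‖ = 1 := by simpa using hx
    have hxB := sphere_subset_closedBall hx
    have h1 : b x = 1 - inner ℝ x (f x) := by
      simp only [b, w, inner_sub_right, real_inner_self_eq_norm_sq, hx1]; norm_num
    have h2 : (inner ℝ x (f x) : ℝ) ≤ ‖x‖ * ‖f x‖ := real_inner_le_norm x (f x)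
    have h3 := hfB x hxB
    rw [hx1, one_mul] at h2
    rcases lt_or_eq_of_le (h2.trans h3) with h | h
    · linarith
    · have h4 : ‖f x‖ = 1 := le_antisymm h3 (h ▸ h2)
      have := inner_eq_norm_mul_iff_real.1 (show inner ℝ x (f x) = ‖x‖ * ‖f x‖ by
        rw [h, hx1, h4, one_mul])
      rw [hx1, h4, one_smul, one_smul] at this
      exact absurd this.symm (hne x hxB)
  have hd0 : ∀ x ∈ closedBall (0 : E) 1, 0 < d x := by
    intro x hx
    have hx1 : ‖x‖ ≤ 1 := by simpa using hx
    rcases lt_or_eq_of_le hx1 with h | h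
    · have : 0 < e x := by
        have := norm_nonneg x
        simp only [e]; nlinarith
      have := mul_pos (ha0 x hx) this
      simp only [d]; positivity
    · have h2 := hb0 x (by simpa using h)
      have h3 : e x = 0 := by simp [e, h]
      simp only [d, h3]; positivity
  let g : E → E := fun x => lam x • w x
  have hg : ∀ x ∈ closedBall (0 : E) 1, ContDiffAt ℝ 1 g x := fun x hx =>
    (((hb.contDiffAt.neg).add (hdd.contDiffAt.sqrt (hd0 x hx).ne')).div ha.contDiffAt
      (ha0 x hx).ne').smul hw.contDiffAt
  refine not_exists_contDiff_retraction (g := g) (g' := fderiv ℝ g)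
    (fun x hx => ((hg x hx).differentiableAt one_ne_zero).hasFDerivAt)
    (fun x hx => ((hg x hx).continuousAt_fderiv one_ne_zero).continuousWithinAt) ?_ ?_
  · intro x hx
    have hx1 : ‖x‖ = 1 := by simpa using hx
    have : lam x = 0 := by
      simp [lam, d, e, hx1, Real.sqrt_sq (hb0 x hx).le]
    simp [g, this]
  · intro x hx
    have hax := ha0 x hx
    have hs := Real.sq_sqrt (hd0 x hx).le
    have h1 : ‖x + g x‖ ^ 2 = ‖x‖ ^ 2 + 2 * lam x * b x + lam x ^ 2 * a x := by
      rw [norm_add_sq_real]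
      simp only [g, inner_smul_right, norm_smul, mul_pow, Real.norm_eq_abs, sq_abs, a, b]
      ring
    have h2 : lam x * a x = -b x + √(d x) := div_mul_cancel₀ _ hax.ne'
    have h3 : a x * (‖x + g x‖ ^ 2 - 1) = 0 := by
      have h4 : a x * (‖x + g x‖ ^ 2 - 1) = (lam x * a x + b x) ^ 2 - d x := by
        rw [h1]; simp only [d, e]; ring
      rw [h4, h2]; nlinarith
    have h5 : ‖x + g x‖ ^ 2 = 1 := by
      rcases mul_eq_zero.1 h3 with h | h
      · exact absurd h hax.ne'
      · linarith
    exact (pow_eq_one_iff_of_nonneg (norm_nonneg _) two_ne_zero).1 h5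

/-- **Brouwer's fixed point theorem** for continuous self-maps with bounded range. -/
theorem exists_fixedPoint_of_norm_le {E : Type*} [NormedAddCommGroup E]
    [InnerProductSpace ℝ E] [FiniteDimensional ℝ E] {f : E → E} (hf : Continuous f)
    {R : ℝ} (hR : ∀ x, ‖f x‖ ≤ R) : ∃ x, f x = x := by
  by_contra! hne
  let r := max R 1
  have hr : 0 < r := lt_max_of_lt_right one_pos
  have hcd : Continuous fun x => ‖f x - x‖ := (hf.sub continuous_id).norm
  obtain ⟨x₀, -, hx₀⟩ := (isCompact_closedBall (0 : E) r).exists_isMinOn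
    ⟨0, by simpa using hr.le⟩ hcd.continuousOn
  let δ := ‖f x₀ - x₀‖
  have hδ : 0 < δ := norm_pos_iff.2 (sub_ne_zero.2 (hne x₀))
  obtain ⟨g, hg, hgf, -⟩ := hf.exists_contDiff_approx 1 (ε := fun _ => δ / 2)
    continuous_const fun _ => by positivity
  let s := r + δ / 2
  have hs : 0 < s := by positivity
  have hg1 : ∀ x, ‖g x‖ ≤ s := fun x => by
    have h1 := hgf x
    rw [dist_eq_norm] at h1
    have h2 := norm_le_insert' (g x) (f x)
    have h3 : ‖f x‖ ≤ r := (hR x).trans (le_max_left _ _)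
    simp only [s]; linarith
  obtain ⟨y, hy, hfix⟩ := exists_fixedPoint_of_contDiff (f := fun x => s⁻¹ • g (r • x))
    ((hg.comp (contDiff_id.const_smul r)).const_smul s⁻¹) (fun x _ => by
      rw [norm_smul, Real.norm_of_nonneg (by positivity), inv_mul_le_one₀ hs]
      exact hg1 _)
  have hz : g (r • y) = s • y := by
    rw [← hfix, smul_inv_smul₀ hs.ne', hfix]
  have hy1 : ‖y‖ ≤ 1 := by simpa using hy
  have h1 : δ ≤ ‖f (r • y) - r • y‖ := hx₀ (by
    simpa [norm_smul, abs_of_pos hr] using mul_le_of_le_one_right hr.le hy1)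
  have h2 : ‖g (r • y) - r • y‖ ≤ δ / 2 := by
    rw [hz, ← sub_smul, norm_smul, show s - r = δ / 2 by simp [s], Real.norm_of_nonneg (by positivity)]
    exact mul_le_of_le_one_right (by positivity) hy1
  have h3 := hgf (r • y)
  rw [dist_comm, dist_eq_norm] at h3
  have h4 := norm_sub_le_norm_sub_add_norm_sub (f (r • y)) (g (r • y)) (r • y)
  linarith


/-- A continuous retraction of `α → ℝ` onto the standard simplex. -/
def simplexRetract {α : Type*} [Fintype α] (x : α → ℝ) (a : α) : ℝ :=
  (max (x a) 0 + max (1 - ∑ b, max (x b) 0) 0) / ∑ c, (max (x c) 0 + max (1 - ∑ b, max (x b) 0) 0)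

theorem simplexRetract_denom_pos {α : Type*} [Fintype α] [Nonempty α] (x : α → ℝ) :
    0 < ∑ c, (max (x c) 0 + max (1 - ∑ b, max (x b) 0) 0) := by
  set S := ∑ b, max (x b) 0
  have hS : 0 ≤ S := Finset.sum_nonneg fun b _ => le_max_right _ _
  rw [Finset.sum_add_distrib, Finset.sum_const, nsmul_eq_mul, Finset.card_univ]
  change 0 < S + _
  have hn : (1 : ℝ) ≤ Fintype.card α := by exact_mod_cast Fintype.card_pos
  have h1 := le_max_left (1 - S) 0
  have h2 := le_max_right (1 - S) 0
  nlinarith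

theorem simplexRetract_mem {α : Type*} [Fintype α] [Nonempty α] (x : α → ℝ) :
    simplexRetract x ∈ stdSimplex ℝ α := by
  refine ⟨fun a => div_nonneg (add_nonneg (le_max_right _ _) (le_max_right _ _))
    (simplexRetract_denom_pos x).le, ?_⟩
  simp only [simplexRetract]
  rw [← Finset.sum_div, div_self (simplexRetract_denom_pos x).ne']

theorem simplexRetract_eq_self {α : Type*} [Fintype α] {x : α → ℝ}
    (hx : x ∈ stdSimplex ℝ α) : simplexRetract x = x := by
  have h : ∀ a, max (x a) 0 = x a := fun a => max_eq_left (hx.1 a)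
  ext a
  simp [simplexRetract, h, hx.2]

theorem continuous_simplexRetract {α : Type*} [Fintype α] [Nonempty α] :
    Continuous (simplexRetract : (α → ℝ) → α → ℝ) := by
  refine continuous_pi fun a => Continuous.div ?_ ?_ fun x => (simplexRetract_denom_pos x).ne' <;>
    fun_prop

/-- The Nash improvement map on the mixed strategies of one player. -/
def nashMap {α : Type*} [Fintype α] (p v : α → ℝ) (a : α) : ℝ :=
  (p a + max (v a - ∑ b, p b * v b) 0) / (1 + ∑ c, max (v c - ∑ b, p b * v b) 0)

theorem nashMap_denom_pos {α : Type*} [Fintype α] (p v : α → ℝ) :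
    0 < 1 + ∑ c, max (v c - ∑ b, p b * v b) 0 :=
  add_pos_of_pos_of_nonneg one_pos (Finset.sum_nonneg fun _ _ => le_max_right _ _)

theorem continuous_nashMap {α : Type*} [Fintype α] :
    Continuous fun q : (α → ℝ) × (α → ℝ) => nashMap q.1 q.2 := by
  refine continuous_pi fun a => Continuous.div ?_ ?_ fun q => (nashMap_denom_pos q.1 q.2).ne' <;>
    fun_prop

theorem nashMap_mem {α : Type*} [Fintype α] {p : α → ℝ} (hp : p ∈ stdSimplex ℝ α) (v : α → ℝ) :
    nashMap p v ∈ stdSimplex ℝ α := by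
  refine ⟨fun a => div_nonneg (add_nonneg (hp.1 a) (le_max_right _ _))
    (nashMap_denom_pos p v).le, ?_⟩
  simp only [nashMap]
  rw [← Finset.sum_div, Finset.sum_add_distrib, hp.2, div_self (nashMap_denom_pos p v).ne']

theorem le_of_nashMap_eq_self {α : Type*} [Fintype α] {p v : α → ℝ} (hp : p ∈ stdSimplex ℝ α)
    (h : nashMap p v = p) {a : α} (ha : 0 < p a) (b : α) : v b ≤ v a := by
  set m := ∑ b, p b * v b with hm
  set S := ∑ c, max (v c - m) 0 with hS
  have hmean : ∑ c, p c * (m - v c) = 0 := by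
    simp_rw [mul_sub, Finset.sum_sub_distrib, ← Finset.sum_mul, hp.2]
    rw [one_mul, ← hm, sub_self]
  have hfix : ∀ c, max (v c - m) 0 = p c * S := by
    intro c
    have h1 : (p c + max (v c - m) 0) / (1 + S) = p c := congrFun h c
    rw [div_eq_iff (nashMap_denom_pos p v).ne'] at h1
    linarith
  have hS0 : S = 0 := by
    by_contra hne
    have hSpos : 0 < S := lt_of_le_of_ne (Finset.sum_nonneg fun _ _ => le_max_right _ _)
      (Ne.symm hne)
    have hlt : ∀ c, 0 < p c → m < v c := by
      intro c hc
      by_contra! hle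
      have h2 := hfix c
      rw [max_eq_right (by linarith)] at h2
      exact (mul_pos hc hSpos).ne h2
    refine (Finset.sum_neg' (s := Finset.univ) (f := fun c => p c * (m - v c)) (fun c _ => ?_)
      ⟨a, Finset.mem_univ a, ?_⟩).ne hmean
    · rcases (hp.1 c).eq_or_lt with h0 | h0
      · simp [← h0]
      · exact (mul_neg_of_pos_of_neg h0 (sub_neg.2 (hlt c h0))).le
    · exact mul_neg_of_pos_of_neg ha (sub_neg.2 (hlt a ha))
  have hle : ∀ c, v c ≤ m := by
    intro c
    have h1 := hfix c
    rw [hS0, mul_zero] at h1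
    have := le_max_left (v c - m) 0
    linarith
  have h0 := (Finset.sum_eq_zero_iff_of_nonneg fun c _ =>
    mul_nonneg (hp.1 c) (sub_nonneg.2 (hle c))).1 hmean a (Finset.mem_univ a)
  have : m = v a := by
    rcases mul_eq_zero.1 h0 with h | h
    · exact absurd h ha.ne'
    · linarith
  exact this ▸ hle b

theorem exists_nash_of_continuousOn {ι : Type*} [Fintype ι] {A : ι → Type*}
    [∀ i, Fintype (A i)] [∀ i, Nonempty (A i)]
    (v : ((i : ι) → A i → ℝ) → (i : ι) → A i → ℝ)
    (hv : ContinuousOn v {p | ∀ i, p i ∈ stdSimplex ℝ (A i)}) :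
    ∃ p : (i : ι) → A i → ℝ, (∀ i, p i ∈ stdSimplex ℝ (A i)) ∧
      ∀ i a, 0 < p i a → ∀ b, v p i b ≤ v p i a := by
  let ρ : EuclideanSpace ℝ (Σ i, A i) → (i : ι) → A i → ℝ :=
    fun x i => simplexRetract fun a => x ⟨i, a⟩
  have hρ : ∀ x i, ρ x i ∈ stdSimplex ℝ (A i) := fun x i => simplexRetract_mem _
  have hρc : Continuous ρ := continuous_pi fun i => continuous_simplexRetract.comp (by fun_prop)
  have hvc : Continuous fun x => v (ρ x) := hv.comp_continuous hρc hρ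
  let T : EuclideanSpace ℝ (Σ i, A i) → EuclideanSpace ℝ (Σ i, A i) := fun x =>
    WithLp.toLp 2 fun s => nashMap (ρ x s.1) (v (ρ x) s.1) s.2
  have hT : Continuous T := by
    refine (PiLp.continuous_toLp 2 _).comp (continuous_pi fun s => ?_)
    exact (continuous_apply s.2).comp <| continuous_nashMap.comp <|
      ((continuous_apply s.1).comp hρc).prodMk ((continuous_apply s.1).comp hvc)
  have hTmem : ∀ x i, (fun a => T x ⟨i, a⟩) ∈ stdSimplex ℝ (A i) := fun x i =>
    nashMap_mem (hρ x i) (v (ρ x) i)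
  obtain ⟨x, hx⟩ := exists_fixedPoint_of_norm_le hT
    (R := √(Fintype.card (Σ i, A i))) fun x => by
      rw [EuclideanSpace.norm_eq]
      refine Real.sqrt_le_sqrt ?_
      calc _ ≤ ∑ s : (Σ i, A i), (1 : ℝ) := Finset.sum_le_sum fun s _ => by
            have h0 := (hTmem x s.1).1 s.2
            have h1 := Finset.single_le_sum (fun a _ => (hTmem x s.1).1 a)
              (Finset.mem_univ s.2)
            rw [(hTmem x s.1).2] at h1
            rw [Real.norm_of_nonneg h0]
            exact pow_le_one₀ h0 h1
        _ = _ := by simp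
  have hself : ∀ i, ρ x i = fun a => x ⟨i, a⟩ := fun i =>
    simplexRetract_eq_self (by rw [← hx]; exact hTmem x i)
  refine ⟨ρ x, hρ x, fun i a ha b => le_of_nashMap_eq_self (hρ x i) ?_ ha b⟩
  conv_rhs => rw [hself i, ← hx]

theorem finsum_mul_payMass {N : ℕ} (G : Game N) (p : Profile G) (i : Fin N) (ai : G.A i)
    (h : ℝ → ℝ) : ∑ᶠ x, h x * payMass G p i ai x = expPayOf G p i ai h := by
  classical
  rw [finsum_eq_sum_of_support_subset (s := Finset.univ.image fun a => G.u a i)]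
  · simp only [payMass, Finset.mul_sum, expPayOf]
    rw [Finset.sum_comm]
    refine Finset.sum_congr rfl fun a _ => ?_
    simp only [mul_ite, mul_zero]
    rw [Finset.sum_ite_eq, if_pos (Finset.mem_image_of_mem _ (Finset.mem_univ a)), mul_comm]
  · intro x hx
    by_contra hn
    refine hx ?_
    have : payMass G p i ai x = 0 := Finset.sum_eq_zero fun a _ => if_neg fun h =>
      hn (by simpa using ⟨a, h⟩)
    simp [this]

theorem Kstat_payMass {N : ℕ} (G : Game N) (p : Profile G) (i : Fin N) (ai : G.A i) {a : EReal}
    (hbot : a ≠ ⊥) (htop : a ≠ ⊤) :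
    Kstat a (payMass G p i ai) = if a = 0 then expPayOf G p i ai id
      else a.toReal⁻¹ * Real.log (expPayOf G p i ai fun x => Real.exp (a.toReal * x)) := by
  rw [Kstat, if_neg htop, if_neg hbot, expOf]
  exact congrArg₂ (ite (a = 0)) (finsum_mul_payMass G p i ai id)
    (by rw [finsum_mul_payMass])

theorem IsMixed.update_delta {N : ℕ} {G : Game N} {p : Profile G} (hp : IsMixed G p) (i : Fin N)
    (ai : G.A i) : IsMixed G (Function.update p i (delta ai)) := by
  classical
  intro j
  rcases eq_or_ne j i with rfl | hj
  · rw [Function.update_self]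
    refine ⟨fun b => ?_, by simp [delta]⟩
    unfold delta; split_ifs <;> norm_num
  · rw [Function.update_of_ne hj]; exact hp j

theorem IsMixed.weight_nonneg {N : ℕ} {G : Game N} {p : Profile G} (hp : IsMixed G p)
    (a : (i : Fin N) → G.A i) : 0 ≤ weight G p a :=
  Finset.prod_nonneg fun j _ => (hp j).1 (a j)

theorem IsMixed.sum_weight {N : ℕ} {G : Game N} {p : Profile G} (hp : IsMixed G p) :
    ∑ a, weight G p a = 1 := by
  simp only [weight]
  rw [← Fintype.piFinset_univ, ← Finset.prod_univ_sum]
  exact Finset.prod_eq_one fun j _ => (hp j).2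

theorem IsMixed.expPayOf_const {N : ℕ} {G : Game N} {p : Profile G} (hp : IsMixed G p)
    (i : Fin N) (ai : G.A i) (c : ℝ) : expPayOf G p i ai (fun _ => c) = c := by
  rw [expPayOf, ← Finset.sum_mul, (hp.update_delta i ai).sum_weight, one_mul]

theorem IsMixed.expPayOf_mono {N : ℕ} {G : Game N} {p : Profile G} (hp : IsMixed G p)
    (i : Fin N) (ai : G.A i) {f g : ℝ → ℝ} (h : ∀ a, f (G.u a i) ≤ g (G.u a i)) :
    expPayOf G p i ai f ≤ expPayOf G p i ai g :=
  Finset.sum_le_sum fun a _ =>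
    mul_le_mul_of_nonneg_left (h a) ((hp.update_delta i ai).weight_nonneg a)

theorem IsMixed.expPayOf_mem_Icc {N : ℕ} {G : Game N} {p : Profile G} (hp : IsMixed G p)
    (i : Fin N) (ai : G.A i) {f : ℝ → ℝ} {c d : ℝ} (h : ∀ a, f (G.u a i) ∈ Set.Icc c d) :
    expPayOf G p i ai f ∈ Set.Icc c d :=
  ⟨(hp.expPayOf_const i ai c).ge.trans (hp.expPayOf_mono i ai fun a => (h a).1),
    (hp.expPayOf_mono i ai fun a => (h a).2).trans (hp.expPayOf_const i ai d).le⟩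

theorem continuous_expPayOf {N : ℕ} (G : Game N) (i : Fin N) (ai : G.A i) (f : ℝ → ℝ) :
    Continuous fun p : Profile G => expPayOf G p i ai f := by
  have hupd : Continuous fun p : Profile G => Function.update p i (delta ai) :=
    continuous_id.update i continuous_const
  unfold expPayOf weight
  refine continuous_finsetSum _ fun a _ => Continuous.mul (continuous_finsetProd _ fun j _ => ?_)
    continuous_const
  exact (continuous_apply (a j)).comp ((continuous_apply j).comp hupd)

theorem IsMixed.expPayOf_exp_pos {N : ℕ} {G : Game N} {p : Profile G} (hp : IsMixed G p)
    (i : Fin N) (ai : G.A i) (t : ℝ) : 0 < expPayOf G p i ai fun x => Real.exp (t * x) := by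
  obtain ⟨M, hM⟩ := (Set.finite_range fun a => t * G.u a i).bddBelow
  exact (Real.exp_pos M).trans_le <| (hp.expPayOf_const i ai _).ge.trans <|
    hp.expPayOf_mono i ai fun a => Real.exp_le_exp.2 (hM ⟨a, rfl⟩)

theorem IsMixed.abs_Kstat_payMass_le {N : ℕ} {G : Game N} {p : Profile G} (hp : IsMixed G p)
    (i : Fin N) (ai : G.A i) {M : ℝ} (hM : ∀ a, |G.u a i| ≤ M) {a : EReal} (hbot : a ≠ ⊥)
    (htop : a ≠ ⊤) : |Kstat a (payMass G p i ai)| ≤ M := by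
  rw [Kstat_payMass G p i ai hbot htop]
  split_ifs with h0
  · exact abs_le.2 (hp.expPayOf_mem_Icc i ai fun b => abs_le.1 (hM b))
  · set t := a.toReal
    have ht : t ≠ 0 := by simpa [t, EReal.toReal_eq_zero_iff, h0, hbot] using htop
    have hb : expPayOf G p i ai (fun x => Real.exp (t * x)) ∈
        Set.Icc (Real.exp (-(|t| * M))) (Real.exp (|t| * M)) := by
      refine hp.expPayOf_mem_Icc i ai fun b => ?_
      have h1 : |t * G.u b i| ≤ |t| * M := by
        rw [abs_mul]; exact mul_le_mul_of_nonneg_left (hM b) (abs_nonneg t)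
      exact ⟨Real.exp_le_exp.2 (abs_le.1 h1).1, Real.exp_le_exp.2 (abs_le.1 h1).2⟩
    have hpos := hp.expPayOf_exp_pos i ai t
    rw [abs_mul, abs_inv, inv_mul_le_iff₀ (abs_pos.2 ht)]
    exact abs_le.2 ⟨(Real.le_log_iff_exp_le hpos).2 hb.1, (Real.log_le_iff_le_exp hpos).2 hb.2⟩

theorem continuousOn_Kstat_payMass {N : ℕ} (G : Game N) (i : Fin N) (ai : G.A i) {a : EReal}
    (hbot : a ≠ ⊥) (htop : a ≠ ⊤) :
    ContinuousOn (fun p => Kstat a (payMass G p i ai)) {p | IsMixed G p} := by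
  simp_rw [fun p => Kstat_payMass G p i ai hbot htop]
  split_ifs
  · exact (continuous_expPayOf G i ai id).continuousOn
  · exact continuousOn_const.mul ((continuous_expPayOf G i ai _).continuousOn.log fun p hp =>
      (IsMixed.expPayOf_exp_pos hp i ai _).ne')

theorem measurable_Kstat_payMass {N : ℕ} (G : Game N) (p : Profile G) (i : Fin N) (ai : G.A i) :
    Measurable fun a => Kstat a (payMass G p i ai) := by
  unfold Kstat
  simp_rw [finsum_mul_payMass, expPayOf]
  refine Measurable.ite (measurableSet_singleton _) measurable_const <|
    Measurable.ite (measurableSet_singleton _) measurable_const <|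
    Measurable.ite (measurableSet_singleton _) measurable_const ?_
  have := measurable_ereal_toReal
  fun_prop

theorem continuousOn_PhiInt_payMass {N : ℕ} (μ : Measure EReal) [IsFiniteMeasure μ]
    (hbot : μ {⊥} = 0) (htop : μ {⊤} = 0) (G : Game N) (i : Fin N) (ai : G.A i) :
    ContinuousOn (fun p => PhiInt μ (payMass G p i ai)) {p | IsMixed G p} := by
  obtain ⟨M, hM⟩ := (Set.finite_range fun a => |G.u a i|).bddAbove
  have hfin : ∀ᵐ a ∂μ, a ≠ ⊥ ∧ a ≠ ⊤ :=
    (measure_eq_zero_iff_ae_notMem.1 hbot).and (measure_eq_zero_iff_ae_notMem.1 htop)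
  rw [continuousOn_iff_continuous_domRestrict]
  refine continuous_of_dominated (bound := fun _ => M)
    (fun p => (measurable_Kstat_payMass G p i ai).aestronglyMeasurable)
    (fun p => ?_) (integrable_const M) ?_
  · filter_upwards [hfin] with a ha
    exact p.2.abs_Kstat_payMass_le i ai (fun b => hM ⟨b, rfl⟩) ha.1 ha.2
  · filter_upwards [hfin] with a ha
    exact (continuousOn_Kstat_payMass G i ai ha.1 ha.2).domRestrict

/-- existence of `Nash_Φ` equilibria for `Φ = ∫ K_a dμ(a)` when `μ`
puts no mass on `±∞`. -/
theorem stmt3 {N : ℕ} (hN : 2 ≤ N) (μ : Measure EReal) [IsProbabilityMeasure μ]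
    (hbot : μ {⊥} = 0) (htop : μ {⊤} = 0) (G : Game N) :
    ∃ p : Profile G, IsMixed G p ∧ IsNashPhi (PhiInt μ) G p :=
  exists_nash_of_continuousOn (fun p i ai => PhiInt μ (payMass G p i ai))
    (continuousOn_pi.2 fun i => continuousOn_pi.2 fun ai =>
      continuousOn_PhiInt_payMass μ hbot htop G i ai)

end Paper
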